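/- Let A = [A11, A12; A21, A22] be a block 2×2 complex matrix with A11 an invertible square matrix. If the imaginary part Im A = (A − Aᴴ)/(2i) is positive semidefinite, then Im(PPT(A)) is positive semidefinite. -/

import Mathlib

open Matrix Complex
open scoped ComplexOrder

/-- The principal pivot transform of a block 2×2 matrix
`A = [A11, A12; A21, A22]` with `A11` an invertible square block:
`PPT(A) = [−A11⁻¹, A11⁻¹A12; A21A11⁻¹, A22 − A21A11⁻¹A12]`. -/
noncomputable def PPT {n m : ℕ} (A : Matrix (Fin n ⊕ Fin m) (Fin n ⊕ Fin m) ℂ) :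
    Matrix (Fin n ⊕ Fin m) (Fin n ⊕ Fin m) ℂ :=
  Matrix.fromBlocks (-(A.toBlocks₁₁)⁻¹) ((A.toBlocks₁₁)⁻¹ * A.toBlocks₁₂)
    (A.toBlocks₂₁ * (A.toBlocks₁₁)⁻¹)
    (A.toBlocks₂₂ - A.toBlocks₂₁ * (A.toBlocks₁₁)⁻¹ * A.toBlocks₁₂)

/-- The imaginary part of a square complex matrix: `Im M = (M − Mᴴ)/(2i)`. -/
noncomputable def matIm {k : Type*} (M : Matrix k k ℂ) : Matrix k k ℂ :=
  (2 * Complex.I)⁻¹ • (M - Mᴴ)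

theorem im_ppt_posSemidef {n m : ℕ}
    (A11 : Matrix (Fin n) (Fin n) ℂ) (A12 : Matrix (Fin n) (Fin m) ℂ)
    (A21 : Matrix (Fin m) (Fin n) ℂ) (A22 : Matrix (Fin m) (Fin m) ℂ)
    (hA11 : IsUnit A11)
    (hIm : (matIm (Matrix.fromBlocks A11 A12 A21 A22)).PosSemidef) :
    (matIm (PPT (Matrix.fromBlocks A11 A12 A21 A22))).PosSemidef := by
  have hdet : IsUnit A11.det := (Matrix.isUnit_iff_isUnit_det A11).mp hA11
  have hZ : A11 * A11⁻¹ = 1 := Matrix.mul_nonsing_inv A11 hdet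
  -- the congruence matrix sending `(y₁, x₂)` to `(x₁, x₂)`
  have key := hIm.conjTranspose_mul_mul_same
    (Matrix.fromBlocks A11⁻¹ (-(A11⁻¹ * A12)) 0 (1 : Matrix (Fin m) (Fin m) ℂ))
  unfold PPT
  simp only [Matrix.toBlocks_fromBlocks₁₁, Matrix.toBlocks_fromBlocks₁₂,
    Matrix.toBlocks_fromBlocks₂₁, Matrix.toBlocks_fromBlocks₂₂]
  generalize A11⁻¹ = Z at *
  set A := Matrix.fromBlocks A11 A12 A21 A22 with hA
  set B := Matrix.fromBlocks Z (-(Z * A12)) 0 (1 : Matrix (Fin m) (Fin m) ℂ) with hB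
  have hAB : A * B = Matrix.fromBlocks 1 0 (A21 * Z) (A22 - A21 * Z * A12) := by
    rw [hA, hB, Matrix.fromBlocks_multiply]
    congr 1
    · simp [hZ]
    · simp [← Matrix.mul_assoc, hZ]
    · simp
    · simp [← Matrix.mul_assoc, sub_eq_add_neg, add_comm]
  have hBAB : Bᴴ * A * B =
      Matrix.fromBlocks Zᴴ 0 (A21 * Z - A12ᴴ * Zᴴ) (A22 - A21 * Z * A12) := by
    rw [Matrix.mul_assoc, hAB, hB, Matrix.fromBlocks_conjTranspose, Matrix.fromBlocks_multiply]
    congr 1 <;> simp [sub_eq_add_neg, add_comm]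
  have hfin : Bᴴ * matIm A * B = (2 * Complex.I)⁻¹ • (Bᴴ * A * B - (Bᴴ * A * B)ᴴ) := by
    simp only [matIm, Matrix.mul_smul, Matrix.smul_mul, Matrix.mul_sub, Matrix.sub_mul,
      Matrix.conjTranspose_mul, Matrix.conjTranspose_conjTranspose, Matrix.mul_assoc]
  rw [hfin, hBAB] at key
  convert key using 1
  unfold matIm
  congr 1
  simp only [Matrix.fromBlocks_conjTranspose, sub_eq_add_neg, Matrix.fromBlocks_neg,
    Matrix.fromBlocks_add]
  congr 1 <;> simp [add_comm]
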